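/- Let D ⊆ U^{|z|} be such that e(D) has finite VC-dimension. Then the following are equivalent: (1) D is Lascar invariant over A; (2) φ(U) is pseudo-invariant over A for every formula φ(w) with parameters in A and a predicate for D; (3) the set D × ¬D = {(a,b) : a ∈ D, b ∉ D} is pseudo-invariant over A. -/

import Mathlib

namespace Paper

open FirstOrder Language Cardinal Set

universe u

variable (L : FirstOrder.Language.{u, u}) (U : Type u) [iS : L.Structure U]

/-- A language consisting of a single `n`-ary relation symbol. -/
def predLang (n : ℕ) : FirstOrder.Language.{u, u} where
  Functions := fun _ => PEmpty
  Relations := fun m => ULift (PLift (m = n))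

/-- The language `L` together with one new `n`-ary relation symbol. -/
def expLang (n : ℕ) : FirstOrder.Language.{u, u} := L.sum (predLang n)

/-- The expansion `⟨U, D⟩` of `U` by a predicate for `D ⊆ U^n`. -/
def expStr {n : ℕ} (D : Set (Fin n → U)) : (expLang L n).Structure U where
  funMap := fun {_} f x =>
    match f with
    | Sum.inl f => Structure.funMap f x
    | Sum.inr f => f.elim
  RelMap := fun {_} r x =>
    match r with
    | Sum.inl r => Structure.RelMap r x
    | Sum.inr h => (x ∘ Fin.cast h.down.down.symm) ∈ D

/-- Add the elements of `A : Set U` as constants to an arbitrary structure on `U`. -/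
def addConsts {L' : FirstOrder.Language.{u, u}} (S : L'.Structure U) (A : Set U) :
    (L'[[↥A]]).Structure U :=
  letI := S
  letI : (constantsOn ↥A).Structure U := constantsOn.structure Subtype.val
  Language.sumStructure _ _ _

/-- Add all elements of `U` as constants to an arbitrary structure on `U`. -/
def addAllConsts {L' : FirstOrder.Language.{u, u}} (S : L'.Structure U) :
    (L'[[U]]).Structure U :=
  letI := S
  letI : (constantsOn U).Structure U := constantsOn.structure id
  Language.sumStructure _ _ _

/-- Realization of a formula with respect to an explicitly given structure. -/
def FRealize {L' : FirstOrder.Language.{u, u}} (S : L'.Structure U) {α : Type*}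
    (φ : L'.Formula α) (v : α → U) : Prop :=
  @Formula.Realize L' U S α φ v

/-- Realization of a sentence with respect to an explicitly given structure. -/
def SentRealize {L' : FirstOrder.Language.{u, u}} (S : L'.Structure U) (φ : L'.Sentence) : Prop :=
  @Sentence.Realize L' U S φ

/-- A structure on `U` is saturated if every type over a parameter set of cardinality `< #U`
which is finitely realized is realized. -/
def IsSatStr {L' : FirstOrder.Language.{u, u}} (S : L'.Structure U) : Prop :=
  ∀ A : Set U, #A < #U → ∀ (m : ℕ) (p : Set ((L'[[↥A]]).Formula (Fin m))),
    (∀ s : Finset ((L'[[↥A]]).Formula (Fin m)), ↑s ⊆ p →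
      ∃ b : Fin m → U, ∀ φ ∈ s, FRealize U (addConsts U S A) φ b) →
    ∃ b : Fin m → U, ∀ φ ∈ p, FRealize U (addConsts U S A) φ b

/-- `D ⊆ U^n` is saturated if the expansion `⟨U, D⟩` is a saturated structure. -/
def SatSet {n : ℕ} (D : Set (Fin n → U)) : Prop :=
  IsSatStr U (expStr L U D)

/-- `⟨U,C⟩ ≡_A ⟨U,D⟩` : the two expansions satisfy the same sentences with parameters in `A`. -/
def EqvOver {n : ℕ} (A : Set U) (C D : Set (Fin n → U)) : Prop :=
  ∀ φ : ((expLang L n)[[↥A]]).Sentence,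
    SentRealize U (addConsts U (expStr L U C) A) φ ↔
      SentRealize U (addConsts U (expStr L U D) A) φ

/-- `e(D/A)`, the class of all `C` with `⟨U,C⟩ ≡_A ⟨U,D⟩`. -/
def eSet {n : ℕ} (A : Set U) (D : Set (Fin n → U)) : Set (Set (Fin n → U)) :=
  {C | EqvOver L U A C D}

/-- The group `Aut(U/A)` of automorphisms of `U` fixing `A` pointwise (as a set). -/
def AutFix (A : Set U) : Set (U ≃[L] U) :=
  {f | ∀ a ∈ A, f a = a}

/-- The image of a set of tuples under an automorphism. -/
def imgSet {n : ℕ} (f : U ≃[L] U) (D : Set (Fin n → U)) : Set (Fin n → U) :=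
  (fun b => ⇑f ∘ b) '' D

/-- The orbit `o(D/A)` of `D` under `Aut(U/A)`. -/
def oSet {n : ℕ} (A : Set U) (D : Set (Fin n → U)) : Set (Set (Fin n → U)) :=
  {C | ∃ f ∈ AutFix L U A, imgSet L U f D = C}

/-- The orbit `o(b/A)` of a tuple `b` under `Aut(U/A)`. -/
def oTuple {n : ℕ} (A : Set U) (b : Fin n → U) : Set (Fin n → U) :=
  {c | ∃ f ∈ AutFix L U A, ⇑f ∘ b = c}

/-- A family of sets shatters `B` if every subset of `B` is the trace of a member. -/
def Shatters {α : Type*} (u : Set (Set α)) (B : Set α) : Prop :=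
  ∀ H ⊆ B, ∃ D ∈ u, D ∩ B = H

/-- A family of sets has finite VC dimension if for some `N` it shatters no `N`-element set. -/
def FiniteVC {α : Type*} (u : Set (Set α)) : Prop :=
  ∃ N : ℕ, ∀ B : Finset α, B.card = N → ¬Shatters u ↑B

/-- `B^{|z|}`, the set of tuples with coordinates in `B`. -/
def tuplesIn {n : ℕ} (B : Set U) : Set (Fin n → U) :=
  {a | ∀ i, a i ∈ B}

/-- `φ(b, U)`, the set defined by `φ(x,z)` with `x ↦ b`. -/
def phiSet {m n : ℕ} (φ : L.Formula (Fin m ⊕ Fin n)) (b : Fin m → U) :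
    Set (Fin n → U) :=
  {a | φ.Realize (Sum.elim b a)}

/-- `D` is approximable by `φ(x,z)` : every finite trace of `D` is the trace of
some instance `φ(b,U)`. -/
def ApproxBy {n : ℕ} (D : Set (Fin n → U)) {m : ℕ} (φ : L.Formula (Fin m ⊕ Fin n)) : Prop :=
  ∀ B : Finset U, ∃ b : Fin m → U,
    phiSet L U φ b ∩ tuplesIn U ↑B = D ∩ tuplesIn U ↑B

/-- `D` is approximable from below by `φ(x,z)`. -/
def ApproxBelowBy {n : ℕ} (D : Set (Fin n → U)) {m : ℕ}
    (φ : L.Formula (Fin m ⊕ Fin n)) : Prop :=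
  ∀ B : Finset U, ∃ b : Fin m → U,
    phiSet L U φ b ∩ tuplesIn U ↑B = D ∩ tuplesIn U ↑B ∧ phiSet L U φ b ⊆ D

/-- `D` is approximable from above by `φ(x,z)`. -/
def ApproxAboveBy {n : ℕ} (D : Set (Fin n → U)) {m : ℕ}
    (φ : L.Formula (Fin m ⊕ Fin n)) : Prop :=
  ∀ B : Finset U, ∃ b : Fin m → U,
    phiSet L U φ b ∩ tuplesIn U ↑B = D ∩ tuplesIn U ↑B ∧ D ⊆ phiSet L U φ b

def Approximable {n : ℕ} (D : Set (Fin n → U)) : Prop :=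
  ∃ (m : ℕ) (φ : L.Formula (Fin m ⊕ Fin n)), ApproxBy L U D φ

def ApproxBelow {n : ℕ} (D : Set (Fin n → U)) : Prop :=
  ∃ (m : ℕ) (φ : L.Formula (Fin m ⊕ Fin n)), ApproxBelowBy L U D φ

def ApproxAbove {n : ℕ} (D : Set (Fin n → U)) : Prop :=
  ∃ (m : ℕ) (φ : L.Formula (Fin m ⊕ Fin n)), ApproxAboveBy L U D φ

/-- The formula `φ(x, a)` (an `L(U)`-formula in the variables `x`), obtained by
substituting the tuple `a` for the variables `z` in `φ(x,z)`. -/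
def instFormula {m n : ℕ} (φ : L.Formula (Fin m ⊕ Fin n)) (a : Fin n → U) :
    (L[[U]]).Formula (Fin m) :=
  ((L.lhomWithConstants U).onFormula φ).subst
    (Sum.elim (fun i => Term.var i) (fun j => (L.con (a j)).term))

/-- A (complete) global type in the variables `x = (x_0, ..., x_{m-1})` : a maximal
finitely realized set of `L(U)`-formulas. -/
def IsGlobalType {m : ℕ} (p : Set ((L[[U]]).Formula (Fin m))) : Prop :=
  (∀ s : Finset ((L[[U]]).Formula (Fin m)), ↑s ⊆ p →
    ∃ b : Fin m → U, ∀ φ ∈ s, FRealize U (addAllConsts U iS) φ b) ∧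
  ∀ φ : (L[[U]]).Formula (Fin m), φ ∈ p ↔ φ.not ∉ p

/-- `D` is externally definable: `D = {a : φ(x,a) ∈ p}` for some global type `p` and
formula `φ(x,z)`. -/
def ExtDefinable {n : ℕ} (D : Set (Fin n → U)) : Prop :=
  ∃ (m : ℕ) (φ : L.Formula (Fin m ⊕ Fin n)) (p : Set ((L[[U]]).Formula (Fin m))),
    IsGlobalType L U p ∧ D = {a | instFormula L U φ a ∈ p}

/-- A sequence of `n`-tuples is indiscernible with respect to the formulas of a
structure `S` on `U`. -/
def IndiscIn {L' : FirstOrder.Language.{u, u}} (S : L'.Structure U) {n : ℕ} {I : Type*} [LinearOrder I]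
    (a : I → Fin n → U) : Prop :=
  ∀ (k : ℕ) (i j : Fin k → I), StrictMono i → StrictMono j →
    ∀ φ : L'.Formula (Fin k × Fin n),
      FRealize U S φ (fun q => a (i q.1) q.2) ↔ FRealize U S φ (fun q => a (j q.1) q.2)

/-- An `A`-indiscernible sequence of `n`-tuples. -/
def IndiscOver {n : ℕ} (A : Set U) {I : Type*} [LinearOrder I] (a : I → Fin n → U) : Prop :=
  IndiscIn U (addConsts U iS A) a


/-- `D` is Lascar invariant over `A` : `D` is invariant over every small model containing `A`. -/
def LascarInv {n : ℕ} (A : Set U) (D : Set (Fin n → U)) : Prop :=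
  ∀ M : L.ElementarySubstructure U, A ⊆ (M : L.Substructure U) →
    #((M : L.Substructure U) : Set U) < #U →
    ∀ f ∈ AutFix L U ((M : L.Substructure U) : Set U), imgSet L U f D = D

/-- The cardinality of the set `L(A)` of formulas with parameters in `A`. -/
def formulaCard (A : Set U) : Cardinal.{u} :=
  #(Σ k : ℕ, (L[[↥A]]).Formula (Fin k))

/-- `u` locally covers `B` (relative to the cardinal `κ`). -/
def LocallyCovers {α : Type u} (κ : Cardinal.{u}) (u : Set (Set α)) (B : Set α) : Prop :=
  ∀ K : Set α, K ⊆ B → #K = κ → ∀ k : ℕ, ∃ D ∈ u, (k : Cardinal.{u}) ≤ #(↥(K ∩ D))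

/-- `φ(x, b)` divides over `A` : for some infinite `K ⊆ o(b/A)` and some `k`,
`{φ(x,c) : c ∈ K}` is `k`-inconsistent. -/
def Divides {m n : ℕ} (φ : L.Formula (Fin m ⊕ Fin n)) (b : Fin n → U) (A : Set U) : Prop :=
  ∃ K : Set (Fin n → U), K ⊆ oTuple L U A b ∧ K.Infinite ∧
    ∃ k : ℕ, ∀ s : Finset (Fin n → U), ↑s ⊆ K → s.card = k →
      ¬∃ x : Fin m → U, ∀ c ∈ s, φ.Realize (Sum.elim x c)

/-- `C` is pseudo-invariant over `A` : `e(C)` locally covers `o(b/A)` for every `b ∈ C`. -/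
def PseudoInv {k : ℕ} (A : Set U) (C : Set (Fin k → U)) : Prop :=
  ∀ b ∈ C, LocallyCovers (#U) (eSet L U (∅ : Set U) C) (oTuple L U A b)

/-- A family `u` of subsets of `U^n` is closed: it is cut out by a set of sentences with a
second-order variable, i.e. sentences of the language expanded by a predicate. -/
def ClosedFam {n : ℕ} (u : Set (Set (Fin n → U))) : Prop :=
  ∃ p : Set ((expLang L n).Sentence),
    u = {D | ∀ φ ∈ p, SentRealize U (expStr L U D) φ}

/-- `κ` is a Ramsey cardinal : every `2`-coloring of the finite subsets of a set of size `κ`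
has a homogeneous set of size `κ`. -/
def IsRamseyCard (κ : Cardinal.{u}) : Prop :=
  ∀ (X : Type u), #X = κ → ∀ c : Finset X → Bool,
    ∃ H : Set X, #H = κ ∧
      ∀ s t : Finset X, ↑s ⊆ H → ↑t ⊆ H → s.card = t.card → c s = c t

/-- The formula `φ(x,z)` is NIP: the family of its instances `φ(a,U)` has finite
VC dimension. -/
def FormulaNIP {m n : ℕ} (φ : L.Formula (Fin m ⊕ Fin n)) : Prop :=
  FiniteVC {E : Set (Fin n → U) | ∃ b : Fin m → U, E = phiSet L U φ b}

/-- The theory of `U` is NIP: every formula is NIP. -/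
def TheoryNIP : Prop :=
  ∀ (m n : ℕ) (φ : L.Formula (Fin m ⊕ Fin n)), FormulaNIP L U φ

/-- A global type `p(z)` is invariant over `A` : each of the sets `D_{p,φ}` is fixed
(setwise) by every automorphism fixing `A` pointwise. -/
def GlobalTypeInv {n : ℕ} (A : Set U) (p : Set ((L[[U]]).Formula (Fin n))) : Prop :=
  ∀ (k : ℕ) (φ : L.Formula (Fin n ⊕ Fin k)) (f : U ≃[L] U), f ∈ AutFix L U A →
    imgSet L U f {a | instFormula L U φ a ∈ p} = {a | instFormula L U φ a ∈ p}

/-- `M` (a subset of `U`) is `L(A;C)`-saturated : every finitely realized type `p(x) ⊆ L(A;C)`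
is realized by a tuple from `M`. -/
def LACSat {n : ℕ} (C : Set (Fin n → U)) (A : Set U) (M : Set U) : Prop :=
  ∀ (m : ℕ) (p : Set (((expLang L n)[[↥A]]).Formula (Fin m))),
    (∀ s : Finset (((expLang L n)[[↥A]]).Formula (Fin m)), ↑s ⊆ p →
      ∃ b : Fin m → U, ∀ φ ∈ s, FRealize U (addConsts U (expStr L U C) A) φ b) →
    ∃ b : Fin m → U, (∀ i, b i ∈ M) ∧
      ∀ φ ∈ p, FRealize U (addConsts U (expStr L U C) A) φ b

/-- The inclusion of languages `L(M) → L(U)` for `M : Set U`. -/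
def liftConsts (M : Set U) : (L[[↥M]]) →ᴸ (L[[U]]) :=
  LHom.sumMap (LHom.id L) (LHom.constantsOnMap Subtype.val)

section

variable {L U}

/-- Saturation, stated for types over a small tuple of parameters. -/
theorem IsSatStr.exists_realize (hsat : IsSatStr U iS) {ι : Type u} (hι : #ι < #U) (w : ι → U)
    (m : ℕ) (p : Set (L.Formula (ι ⊕ Fin m)))
    (hp : ∀ s : Finset (L.Formula (ι ⊕ Fin m)), ↑s ⊆ p →
      ∃ b : Fin m → U, ∀ φ ∈ s, φ.Realize (Sum.elim w b)) :
    ∃ b : Fin m → U, ∀ φ ∈ p, φ.Realize (Sum.elim w b) := by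
  classical
  let e : L.Formula (ι ⊕ Fin m) → (L[[↥(range w)]]).Formula (Fin m) := fun φ =>
    BoundedFormula.constantsVarsEquiv.symm (φ.relabel (Sum.map (rangeFactorization w) id))
  have he : ∀ φ b, FRealize U (addConsts U iS (range w)) (e φ) b ↔
      φ.Realize (Sum.elim w b) := by
    intro φ b
    have h := BoundedFormula.realize_constantsVarsEquiv (L := L) (M := U) (α := ↥(range w))
      (φ := e φ) (v := b) (xs := default)
    simp only [e, Equiv.apply_symm_apply] at h
    refine h.symm.trans ?_
    refine Formula.realize_relabel.trans ?_
    rw [Sum.elim_comp_map]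
    rfl
  obtain ⟨b, hb⟩ := hsat (range w) (mk_range_le.trans_lt hι) m (e '' p) (by
    intro s hs
    obtain ⟨t, ht, rfl⟩ := Finset.subset_set_image_iff.1 hs
    obtain ⟨b, hb⟩ := hp t ht
    refine ⟨b, fun φ hφ => ?_⟩
    obtain ⟨ψ, hψ, rfl⟩ := Finset.mem_image.1 hφ
    exact (he ψ b).2 (hb ψ hψ))
  exact ⟨b, fun φ hφ => (he φ b).1 (hb _ (mem_image_of_mem e hφ))⟩

/-- A relation on `U` is elementary if the two coordinates of its elements satisfy the same
formulas. -/
def IsElemRel (L : FirstOrder.Language.{u, u}) {U : Type u} [L.Structure U]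
    (R : Set (U × U)) : Prop :=
  ∀ φ : L.Formula R, φ.Realize (fun x => x.1.1) ↔ φ.Realize (fun x => x.1.2)

theorem IsElemRel.realize_iff {R : Set (U × U)} (hR : IsElemRel L R) {ι : Type*} {v w : ι → U}
    (h : ∀ i, (v i, w i) ∈ R) (φ : L.Formula ι) : φ.Realize v ↔ φ.Realize w := by
  have := hR (φ.relabel fun i => ⟨(v i, w i), h i⟩)
  rwa [Formula.realize_relabel, Formula.realize_relabel] at this

theorem isElemRel_range {ι : Type*} {v w : ι → U}
    (h : ∀ φ : L.Formula ι, φ.Realize v ↔ φ.Realize w) :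
    IsElemRel L (range fun i => (v i, w i)) := by
  intro φ
  choose f hf using fun x : range (fun i => (v i, w i)) => x.2
  have := h (φ.relabel f)
  rw [Formula.realize_relabel, Formula.realize_relabel] at this
  convert this using 2
  · ext x
    exact congrArg Prod.fst (hf x).symm
  · ext x
    exact congrArg Prod.snd (hf x).symm

theorem IsElemRel.swap {R : Set (U × U)} (hR : IsElemRel L R) :
    IsElemRel L (Prod.swap '' R) := by
  have h : Prod.swap '' R = range fun x : R => (x.1.2, x.1.1) := by
    ext x
    simp [eq_comm, Prod.ext_iff, and_comm]
  rw [h]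
  exact isElemRel_range fun φ => (hR φ).symm

theorem isElemRel_iUnion {I : Type*} [Nonempty I] {R : I → Set (U × U)}
    (hd : Directed (· ⊆ ·) R) (h : ∀ i, IsElemRel L (R i)) : IsElemRel L (⋃ i, R i) := by
  classical
  intro φ
  have hfin : (Subtype.val '' (φ.freeVarFinset : Set (⋃ i, R i))).Finite :=
    (Finset.finite_toSet _).image _
  obtain ⟨i, hi⟩ := hd.exists_mem_subset_of_finset_subset_biUnion (s := hfin.toFinset) (by
    rw [hfin.coe_toFinset]
    rintro _ ⟨x, -, rfl⟩
    exact x.2)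
  rw [hfin.coe_toFinset] at hi
  have hmem : ∀ x : φ.freeVarFinset, x.1.1 ∈ R i := fun x => hi ⟨x.1, x.2, rfl⟩
  have := h i (φ.restrictFreeVar fun x => ⟨x.1.1, hmem x⟩)
  rw [Formula.Realize, Formula.Realize,
    BoundedFormula.realize_restrictFreeVar (fun x : ⋃ i, R i => x.1.1) (by simp),
    BoundedFormula.realize_restrictFreeVar (fun x : ⋃ i, R i => x.1.2) (by simp)] at this
  exact this

theorem IsElemRel.exists_insert (hsat : IsSatStr U iS) {R : Set (U × U)} (hR : IsElemRel L R)
    (hc : #R < #U) (a : U) : ∃ b, IsElemRel L (insert (a, b) R) := by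
  classical
  obtain ⟨b, hb⟩ := hsat.exists_realize hc (fun x : R => x.1.2) 1
    {φ : L.Formula (R ⊕ Fin 1) | φ.Realize (Sum.elim (fun x => x.1.1) fun _ => a)} (by
      intro s hs
      have h1 : ((Formula.iInf fun φ : s => φ.1).iExs (Fin 1)).Realize
          (fun x : R => x.1.1) := by
        rw [Formula.realize_iExs]
        exact ⟨fun _ => a, Formula.realize_iInf.2 fun φ => hs φ.2⟩
      rw [hR, Formula.realize_iExs] at h1
      obtain ⟨b, hb⟩ := h1
      rw [Formula.realize_iInf] at hb
      exact ⟨b, fun φ hφ => hb ⟨φ, hφ⟩⟩)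
  refine ⟨b 0, ?_⟩
  have hrange : insert (a, b 0) R = range fun i : R ⊕ Fin 1 =>
      ((Sum.elim (fun x => x.1.1) (fun _ => a) i : U),
        (Sum.elim (fun x : R => x.1.2) b i : U)) := by
    ext x
    simp [eq_comm, or_comm]
  rw [hrange]
  refine isElemRel_range fun φ => ⟨fun h => hb φ h, fun h => ?_⟩
  by_contra h'
  exact Formula.realize_not.1 (hb φ.not (Formula.realize_not.2 h')) h

theorem IsElemRel.exists_superset (hsat : IsSatStr U iS) (hinf : ℵ₀ ≤ #U) {R : Set (U × U)}
    (hR : IsElemRel L R) (hc : #R < #U) (a : U) :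
    ∃ S, R ⊆ S ∧ IsElemRel L S ∧ #S < #U ∧ (∃ b, (a, b) ∈ S) ∧ ∃ b, (b, a) ∈ S := by
  have hins : ∀ (S : Set (U × U)) x, #S < #U → #↥(insert x S) < #U := fun S x hS =>
    (mk_insert_le).trans_lt (add_lt_of_lt hinf hS (one_lt_aleph0.trans_le hinf))
  obtain ⟨b, hb⟩ := hR.exists_insert hsat hc a
  have hc1 := hins R (a, b) hc
  obtain ⟨b', hb'⟩ := hb.swap.exists_insert hsat (mk_image_le.trans_lt hc1) a
  refine ⟨insert (b', a) (insert (a, b) R), ?_, ?_, hins _ _ hc1, ⟨b, by simp⟩, ⟨b', by simp⟩⟩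
  · exact (subset_insert _ _).trans (subset_insert _ _)
  · have := hb'.swap
    rwa [image_insert_eq, image_image, Prod.swap_prod_mk, image_congr fun x _ => Prod.swap_swap x,
      image_id'] at this

theorem IsElemRel.exists_equiv {R : Set (U × U)} (hR : IsElemRel L R)
    (hl : ∀ a, ∃ b, (a, b) ∈ R) (hr : ∀ b, ∃ a, (a, b) ∈ R) :
    ∃ g : U ≃[L] U, ∀ a b, (a, b) ∈ R → g a = b := by
  choose g hg using hl
  have key : ∀ {a b a' b'}, (a, b) ∈ R → (a', b') ∈ R → (a = a' ↔ b = b') := by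
    intro a b a' b' h h'
    have := hR.realize_iff (v := ![a, a']) (w := ![b, b'])
      (fun i => by fin_cases i <;> assumption)
      (Term.equal (Term.var (0 : Fin 2)) (Term.var (1 : Fin 2)))
    simpa [Term.equal, Formula.Realize] using this
  have hgb : Function.Bijective g :=
    ⟨fun a a' h => (key (hg a) (hg a')).2 h, fun b => by
      obtain ⟨a, ha⟩ := hr b
      exact ⟨a, (key (hg a) ha).1 rfl⟩⟩
  refine ⟨{ Equiv.ofBijective g hgb with
    map_fun' := ?_
    map_rel' := ?_ }, fun a b h => (key (hg a) h).1 rfl⟩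
  · intro m f x
    have := hR.realize_iff (v := Fin.snoc x (Structure.funMap f x))
      (w := Fin.snoc (g ∘ x) (g (Structure.funMap f x))) (fun i => by
        refine Fin.lastCases ?_ (fun j => ?_) i
        · simpa using hg _
        · simpa using hg _)
      (Term.equal (Term.func f fun j => Term.var (Fin.castSucc j)) (Term.var (Fin.last m)))
    simp [Term.equal, Formula.Realize] at this
    exact this.symm
  · intro m r x
    exact (hR.realize_iff (v := x) (w := g ∘ x) (fun i => hg _)
      (r.formula fun j => Term.var j)).symm

/-- Saturated structures of regular cardinality are strongly homogeneous. -/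
theorem IsSatStr.exists_automorphism (hsat : IsSatStr U iS) (hreg : (#U).IsRegular)
    {ι : Type u} (hι : #ι < #U) {v w : ι → U}
    (h : ∀ φ : L.Formula ι, φ.Realize v ↔ φ.Realize w) :
    ∃ g : U ≃[L] U, ∀ i, g (v i) = w i := by
  classical
  let I := (#U).ord.ToType
  have hI : #I = #U := by simp [I]
  obtain ⟨e⟩ : Nonempty (I ≃ U) := Cardinal.eq.1 hI
  have hIio : ∀ i : I, #(Iio i) < #U := fun i => (mk_Iio_lt i (by simp [I])).trans_eq hI
  have : Nonempty I := e.nonempty_congr.2 (mk_ne_zero_iff.1 hreg.pos.ne')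
  let R₀ : Set (U × U) := range fun i => (v i, w i)
  let step : Set (U × U) → U → Set (U × U) := fun R a =>
    if hR : IsElemRel L R ∧ #R < #U then (hR.1.exists_superset hsat hreg.aleph0_le hR.2 a).choose
    else R
  let F : I → Set (U × U) := WellFoundedLT.fix fun i F => step (R₀ ∪ ⋃ j : Iio i, F j.1 j.2) (e i)
  have hF : ∀ i, F i = step (R₀ ∪ ⋃ j : Iio i, F j) (e i) := fun i =>
    WellFoundedLT.fix_eq _ i
  have hstep : ∀ R a, IsElemRel L R → #R < #U → R ⊆ step R a ∧ IsElemRel L (step R a) ∧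
      #(step R a) < #U ∧ (∃ b, (a, b) ∈ step R a) ∧ ∃ b, (b, a) ∈ step R a := by
    intro R a h1 h2
    simp only [step, dif_pos (And.intro h1 h2)]
    exact (h1.exists_superset hsat hreg.aleph0_le h2 a).choose_spec
  have hpre : ∀ i, IsElemRel L (F i) ∧ #(F i) < #U ∧
      IsElemRel L (R₀ ∪ ⋃ j : Iio i, F j) ∧ #↥(R₀ ∪ ⋃ j : Iio i, F j) < #U := by
    intro i
    induction i using WellFoundedLT.induction with
    | ind i ih =>
      have hsub : ∀ j, j < i → R₀ ∪ ⋃ k : Iio j, F k ⊆ F j := fun j hj => by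
        rw [hF j]
        exact (hstep _ _ (ih j hj).2.2.1 (ih j hj).2.2.2).1
      have h1 : IsElemRel L (R₀ ∪ ⋃ j : Iio i, F j) := by
        rcases isEmpty_or_nonempty (Iio i) with hE | hE
        · simpa using isElemRel_range h
        · rw [union_eq_right.2 (by
            obtain ⟨j⟩ := hE
            exact (subset_union_left.trans (hsub j j.2)).trans
              (subset_iUnion (fun j : Iio i => F j) j))]
          refine isElemRel_iUnion (Monotone.directed_le fun j k hjk => ?_) fun j => (ih j j.2).1
          rcases hjk.eq_or_lt with rfl | hjk
          · exact subset_rfl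
          · exact (subset_iUnion (fun l : Iio k.1 => F l) ⟨j, hjk⟩).trans
              (subset_union_right.trans (hsub k k.2))
      have h2 : #↥(R₀ ∪ ⋃ j : Iio i, F j) < #U := by
        refine (mk_union_le _ _).trans_lt (add_lt_of_lt hreg.aleph0_le
          (mk_range_le.trans_lt hι) ?_)
        exact (card_iUnion_lt_iff_forall_of_isRegular hreg (hIio i)).2 fun j => (ih j j.2).2.1
      have h3 := hstep _ (e i) h1 h2
      rw [← hF] at h3
      exact ⟨h3.2.1, h3.2.2.1, h1, h2⟩
  have hprop : ∀ i, R₀ ∪ ⋃ j : Iio i, F j ⊆ F i ∧ (∃ b, (e i, b) ∈ F i) ∧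
      ∃ b, (b, e i) ∈ F i := fun i => by
    have h3 := hstep _ (e i) (hpre i).2.2.1 (hpre i).2.2.2
    rw [← hF] at h3
    exact ⟨h3.1, h3.2.2.2⟩
  have hmono : Monotone F := fun j k hjk => by
    rcases hjk.eq_or_lt with rfl | hjk
    · exact subset_rfl
    · exact (subset_iUnion (fun l : Iio k => F l) ⟨j, hjk⟩).trans
        (subset_union_right.trans (hprop k).1)
  obtain ⟨g, hg⟩ := (isElemRel_iUnion hmono.directed_le fun i => (hpre i).1).exists_equiv
    (fun a => by
      obtain ⟨b, hb⟩ := (hprop (e.symm a)).2.1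
      exact ⟨b, mem_iUnion.2 ⟨_, by simpa using hb⟩⟩)
    (fun a => by
      obtain ⟨b, hb⟩ := (hprop (e.symm a)).2.2
      exact ⟨b, mem_iUnion.2 ⟨_, by simpa using hb⟩⟩)
  refine ⟨g, fun i => hg _ _ (mem_iUnion.2 ⟨Classical.arbitrary I, ?_⟩)⟩
  exact (hprop _).1 (Or.inl ⟨i, rfl⟩)

theorem fRealize_comp_equiv {L' : FirstOrder.Language.{u, u}} {S T : L'.Structure U}
    (g : U ≃ U)
    (hfun : ∀ (m : ℕ) (f : L'.Functions m) x, g (S.funMap f x) = T.funMap f (g ∘ x))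
    (hrel : ∀ (m : ℕ) (r : L'.Relations m) x, T.RelMap r (g ∘ x) ↔ S.RelMap r x)
    {α : Type*} (φ : L'.Formula α) (v : α → U) :
    FRealize U T φ (g ∘ v) ↔ FRealize U S φ v :=
  let e : @Language.Equiv L' U U S T :=
    @Language.Equiv.mk L' U U S T g (fun {m} f x => hfun m f x) (fun {m} r x => hrel m r x)
  @StrongHomClass.realize_formula L' U U S T α _ _ (@Equiv.instStrongHomClass L' U U S T) e φ v

theorem mem_imgSet_comp {n : ℕ} (g : U ≃[L] U) (D : Set (Fin n → U)) (x : Fin n → U) :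
    ⇑g ∘ x ∈ imgSet L U g D ↔ x ∈ D :=
  (Function.Injective.comp_left g.injective).mem_set_image

/-- Automorphisms transport formulas with a predicate for `D` to formulas with a predicate for the
image of `D`. -/
theorem fRealize_expStr_imgSet {n : ℕ} {A : Set U} {g : U ≃[L] U} (hg : g ∈ AutFix L U A)
    (D : Set (Fin n → U)) {α : Type*} (φ : ((expLang L n)[[↥A]]).Formula α) (v : α → U) :
    FRealize U (addConsts U (expStr L U (imgSet L U g D)) A) φ (g ∘ v) ↔
      FRealize U (addConsts U (expStr L U D) A) φ v := by
  refine fRealize_comp_equiv g.toEquiv ?_ ?_ φ v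
  · intro m f x
    rcases f with (f | f) | f
    · exact g.map_fun f x
    · exact f.elim
    · cases m with
      | zero => exact hg _ (Subtype.mem _)
      | succ m => exact f.elim
  · intro m r x
    rcases r with (r | r) | r
    · exact g.map_rel r x
    · exact mem_imgSet_comp g D _
    · exact r.elim

theorem imgSet_mem_eSet {n : ℕ} {A : Set U} {g : U ≃[L] U} (hg : g ∈ AutFix L U A)
    {C D : Set (Fin n → U)} (hC : C ∈ eSet L U A D) : imgSet L U g C ∈ eSet L U A D := by
  intro φ
  rw [← hC φ]
  have := fRealize_expStr_imgSet hg C φ default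
  rwa [Unique.eq_default (⇑g ∘ default)] at this

theorem mem_autFix_empty (g : U ≃[L] U) : g ∈ AutFix L U ∅ := fun _ h => h.elim

theorem mem_eSet_self {n : ℕ} (A : Set U) (D : Set (Fin n → U)) : D ∈ eSet L U A D :=
  fun _ => Iff.rfl

/-- The image of an elementary substructure under an automorphism is elementary. -/
theorem exists_elementarySubstructure_coe_eq_image (M : L.ElementarySubstructure U)
    (g : U ≃[L] U) : ∃ N : L.ElementarySubstructure U,
      ((N : L.Substructure U) : Set U) = g '' ((M : L.Substructure U) : Set U) := by
  refine ⟨⟨(M : L.Substructure U).map g.toHom, ?_⟩, rfl⟩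
  refine Substructure.isElementary_of_exists _ fun m φ x a h => ?_
  have hx : ∀ i, ∃ y : M, g y = x i := fun i => by
    obtain ⟨y, hy, h⟩ := (x i).2
    exact ⟨⟨y, hy⟩, h⟩
  choose y hy using hx
  have hsn : ∀ b : U, (g ∘ Fin.snoc (M.subtype ∘ y) b : Fin (m + 1) → U) =
      Fin.snoc (Subtype.val ∘ x) (g b) := fun b =>
    (Fin.comp_snoc ..).trans
      (congrArg (fun z : Fin m → U => (Fin.snoc z (g b) : Fin (m + 1) → U)) (funext hy))
  have h' : φ.Realize default (Fin.snoc (M.subtype ∘ y) (g.symm a) : Fin (m + 1) → U) := by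
    rw [← StrongHomClass.realize_boundedFormula g φ, hsn, Unique.eq_default (⇑g ∘ default)]
    simpa using h
  have h2 : φ.ex.Realize (default : Empty → U) (M.subtype ∘ y) :=
    BoundedFormula.realize_ex.2 ⟨_, h'⟩
  rw [← Unique.eq_default (M.subtype ∘ default), M.subtype.map_boundedFormula,
    BoundedFormula.realize_ex] at h2
  obtain ⟨b, hb⟩ := h2
  rw [← M.subtype.map_boundedFormula, Fin.comp_snoc, ← StrongHomClass.realize_boundedFormula g φ,
    hsn, Unique.eq_default (⇑g ∘ _)] at hb
  exact ⟨⟨g b, b, b.2, rfl⟩, hb⟩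

theorem exists_small_elementarySubstructure (hinf : ℵ₀ < #U) (hcard : L.card < #U) {A : Set U}
    (hA : #A < #U) : ∃ M : L.ElementarySubstructure U, A ⊆ (M : L.Substructure U) ∧
      #((M : L.Substructure U) : Set U) < #U := by
  obtain ⟨M, hAM, hM⟩ := exists_elementarySubstructure_card_eq L A (max ℵ₀ (max #A L.card))
    (le_max_left _ _) (by simp) (by simp)
    (by simpa using ⟨hinf.le, hA.le, hcard.le⟩)
  refine ⟨M, hAM, ?_⟩
  rw [lift_id, lift_id] at hM
  exact hM.trans_lt (max_lt hinf (max_lt hA hcard))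

/-- Tuples with the same type over a small set are conjugate over it. -/
theorem IsSatStr.exists_autFix (hsat : IsSatStr U iS) (hreg : (#U).IsRegular) {M : Set U}
    (hM : #M < #U) {β : Type} [Finite β] {v w : β → U}
    (h : ∀ φ : L.Formula (M ⊕ β), φ.Realize (Sum.elim (↑) v) ↔ φ.Realize (Sum.elim (↑) w)) :
    ∃ g ∈ AutFix L U M, ⇑g ∘ v = w := by
  have hι : #(M ⊕ ULift.{u} β) < #U := by
    rw [mk_sum, lift_id, lift_id]
    exact add_lt_of_lt hreg.aleph0_le hM ((lt_aleph0_of_finite _).trans_le hreg.aleph0_le)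
  obtain ⟨g, hg⟩ := hsat.exists_automorphism hreg hι
    (v := Sum.elim (↑) (v ∘ ULift.down)) (w := Sum.elim (↑) (w ∘ ULift.down)) (fun φ => by
      have := h (φ.relabel (Sum.map id ULift.down))
      rwa [Formula.realize_relabel, Formula.realize_relabel, Sum.elim_comp_map,
        Sum.elim_comp_map] at this)
  exact ⟨g, fun a ha => hg (Sum.inl ⟨a, ha⟩), funext fun i => hg (Sum.inr ⟨i⟩)⟩

/-- Formulas over the parameters `A` and a predicate for a Lascar invariant set define
pseudo-invariant sets. -/
theorem LascarInv.pseudoInv (hsat : IsSatStr U iS) (hinacc : Cardinal.IsInaccessible #U)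
    (hcard : L.card < #U) {n : ℕ} {A : Set U} (hA : #A < #U) {D : Set (Fin n → U)}
    (hD : LascarInv L U A D) {k : ℕ} (φ : ((expLang L n)[[↥A]]).Formula (Fin k)) :
    PseudoInv L U A {a : Fin k → U | FRealize U (addConsts U (expStr L U D) A) φ a} := by
  intro b hb K hK hKc m
  obtain ⟨M, hAM, hM⟩ := exists_small_elementarySubstructure hinacc.aleph0_lt hcard hA
  set M' : Set U := ((M : L.Substructure U) : Set U) with hM'
  have htypes : #(Set (L.Formula (M' ⊕ Fin k))) < #K := by
    rw [hKc, mk_set]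
    refine hinacc.isStrongLimit.isStrongPrelimit ?_
    have h1 : #(L.Formula (M' ⊕ Fin k)) ≤ #(Σ m, L.BoundedFormula (M' ⊕ Fin k) m) :=
      mk_le_of_injective (f := fun ψ => ⟨0, ψ⟩) fun _ _ h => by simpa using h
    refine (h1.trans BoundedFormula.card_le).trans_lt ?_
    simp only [lift_id, mk_sum, lift_uzero]
    refine max_lt hinacc.aleph0_lt (add_lt_of_lt hinacc.aleph0_lt.le (add_lt_of_lt
      hinacc.aleph0_lt.le hM ?_) hcard)
    simpa using hinacc.nat_lt k
  have : Infinite K := by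
    rw [Cardinal.infinite_iff, hKc]
    exact hinacc.aleph0_lt.le
  obtain ⟨p, hp⟩ := exists_infinite_fiber
    (fun a : K => {ψ : L.Formula (M' ⊕ Fin k) | ψ.Realize (Sum.elim (↑) a.1)}) htypes
  obtain ⟨a₀⟩ : Nonempty _ := hp.nonempty
  obtain ⟨g, hg, hgb⟩ := hK a₀.1.2
  set C := {a : Fin k → U | FRealize U (addConsts U (expStr L U D) A) φ a} with hC
  refine ⟨imgSet L U g C, imgSet_mem_eSet (mem_autFix_empty g) (mem_eSet_self _ _), ?_⟩
  obtain ⟨N, hN⟩ := exists_elementarySubstructure_coe_eq_image M g.symm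
  have hAN : A ⊆ (N : L.Substructure U) := by
    rw [hN]
    exact fun x hx => ⟨x, hAM hx, (congrArg g.symm (hg x hx)).symm.trans (g.symm_apply_apply x)⟩
  have hmem : ∀ a ∈ (fun a : K => {ψ : L.Formula (M' ⊕ Fin k) | ψ.Realize (Sum.elim (↑) a.1)}) ⁻¹'
      {p}, a.1 ∈ imgSet L U g C := by
    intro a ha
    have heq := ha.trans a₀.2.symm
    obtain ⟨h, hh, hha⟩ := hsat.exists_autFix hinacc.isRegular hM (v := a₀.1.1) (w := a.1)
      (fun ψ => (Set.ext_iff.1 heq ψ).symm)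
    let f : U ≃[L] U := (g.symm.comp h).comp g
    have hf : f ∈ AutFix L U ((N : L.Substructure U) : Set U) := by
      rw [hN]
      rintro _ ⟨x, hx, rfl⟩
      simp [f, hh x hx]
    refine ⟨f ∘ b, ?_, ?_⟩
    · have h1 := fRealize_expStr_imgSet (fun x hx => hf x (hAN hx)) D φ b
      rw [hD N hAN (by rw [hN]; exact mk_image_le.trans_lt hM) f hf] at h1
      exact h1.2 hb
    · funext i
      simp [f, ← hha, ← hgb]
  refine le_trans ?_ (mk_le_of_injective (f := fun a : ((fun a : K => {ψ : L.Formula (M' ⊕ Fin k) |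
    ψ.Realize (Sum.elim (↑) a.1)}) ⁻¹' {p}) => (⟨a.1.1, a.1.2, hmem a.1 a.2⟩ :
      ↥(K ∩ imgSet L U g C))) fun a a' h => ?_)
  · exact (natCast_lt_aleph0.le).trans (Cardinal.infinite_iff.1 hp)
  · exact Subtype.ext (Subtype.ext (Subtype.mk.inj h))

theorem comp_append {α β : Type*} {m n : ℕ} (f : α → β) (x : Fin m → α) (y : Fin n → α) :
    f ∘ Fin.append x y = Fin.append (f ∘ x) (f ∘ y) := by
  funext i
  refine Fin.addCases (fun i => ?_) (fun i => ?_) i <;>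
    simp only [Function.comp_apply, Fin.append_left, Fin.append_right]

/-- The new relation symbol of the language with a predicate and with parameters in `A`. -/
def newRel (L : FirstOrder.Language.{u, u}) {U : Type u} (n : ℕ) (A : Set U) :
    ((expLang L n)[[↥A]]).Relations n :=
  Sum.inl (Sum.inr ⟨⟨rfl⟩⟩)

theorem fRealize_newRel {n : ℕ} (A : Set U) (D : Set (Fin n → U)) {α : Type*}
    (t : Fin n → α) (v : α → U) :
    FRealize U (addConsts U (expStr L U D) A) ((newRel L n A).formula fun i => Term.var (t i)) v ↔
      (fun i => v (t i)) ∈ D := by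
  let := addConsts U (expStr L U D) A
  exact Formula.realize_rel

/-- The set of those `x` with `(x, y) ∈ E` for some `y`. -/
def domSet {U : Type u} {n : ℕ} (E : Set (Fin (n + n) → U)) : Set (Fin n → U) :=
  {x | ∃ y : Fin n → U, Fin.append x y ∈ E}

theorem exists_term_domSet {n : ℕ} (A : Set U) {α : Type*} (t : ((expLang L n)[[↥A]]).Term α) :
    ∃ t' : ((expLang L (n + n))[[↥A]]).Term α, ∀ (E : Set (Fin (n + n) → U)) (v : α → U),
      @Term.realize _ U (addConsts U (expStr L U E) A) _ v t' =
        @Term.realize _ U (addConsts U (expStr L U (domSet E)) A) _ v t := by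
  induction t with
  | var a => exact ⟨Term.var a, fun _ _ => rfl⟩
  | @func m f ts ih =>
    choose ts' hts using ih
    rcases f with (f | f) | f
    · exact ⟨Term.func (Sum.inl (Sum.inl f)) ts', fun E v =>
        congrArg (fun x => Structure.funMap f x) (funext fun i => hts i E v)⟩
    · exact f.elim
    · cases m with
      | zero => exact ⟨Term.func (Sum.inr f) ts', fun _ _ => rfl⟩
      | succ m => exact f.elim

theorem exists_formula_mem_domSet (L : FirstOrder.Language.{u, u}) {U : Type u} [L.Structure U]
    (n : ℕ) (A : Set U) :
    ∃ χ : ((expLang L (n + n))[[↥A]]).Formula (Fin n), ∀ (E : Set (Fin (n + n) → U)) x,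
      FRealize U (addConsts U (expStr L U E) A) χ x ↔ x ∈ domSet E := by
  refine ⟨((newRel L (n + n) A).formula fun i =>
    Term.var (Fin.append (m := n) (n := n) Sum.inl Sum.inr i)).iExs (Fin n), fun E x => ?_⟩
  let := addConsts U (expStr L U E) A
  refine Formula.realize_iExs.trans (exists_congr fun y => ?_)
  refine (fRealize_newRel A E _ _).trans (Iff.of_eq (congrArg (· ∈ E) ?_))
  exact comp_append (Sum.elim x y) _ _

theorem exists_boundedFormula_domSet {n : ℕ} (A : Set U) {α : Type*} {k : ℕ}
    (φ : ((expLang L n)[[↥A]]).BoundedFormula α k) :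
    ∃ ψ : ((expLang L (n + n))[[↥A]]).BoundedFormula α k,
      ∀ (E : Set (Fin (n + n) → U)) (v : α → U) (xs : Fin k → U),
        @BoundedFormula.Realize _ U (addConsts U (expStr L U E) A) _ _ ψ v xs ↔
          @BoundedFormula.Realize _ U (addConsts U (expStr L U (domSet E)) A) _ _ φ v xs := by
  induction φ with
  | falsum => exact ⟨⊥, fun _ _ _ => Iff.rfl⟩
  | equal t₁ t₂ =>
    obtain ⟨s₁, h₁⟩ := exists_term_domSet A t₁
    obtain ⟨s₂, h₂⟩ := exists_term_domSet A t₂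
    exact ⟨BoundedFormula.equal s₁ s₂, fun E v xs => by
      simp only [BoundedFormula.Realize, h₁, h₂]⟩
  | @rel k m r ts =>
    choose ts' hts using fun i => exists_term_domSet A (ts i)
    rcases r with (r | r) | r
    · exact ⟨BoundedFormula.rel (Sum.inl (Sum.inl r)) ts', fun E v xs => Iff.of_eq
        (congrArg (fun x => Structure.RelMap r x) (funext fun i => hts i E _))⟩
    · obtain ⟨⟨rfl⟩⟩ := r
      obtain ⟨χ, hχ⟩ := exists_formula_mem_domSet L m A
      refine ⟨(χ.subst ts').relabel (n := k) id, fun E v xs => ?_⟩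
      let := addConsts U (expStr L U E) A
      refine (BoundedFormula.realize_relabel (n := 0)).trans (BoundedFormula.realize_subst.trans ?_)
      refine (Iff.of_eq (congrArg (BoundedFormula.Realize χ _) (Subsingleton.elim _ default))).trans ?_
      refine (hχ E _).trans (Iff.of_eq (congrArg (· ∈ domSet E) ?_))
      exact funext fun i => hts i E _
    · exact r.elim
  | imp φ₁ φ₂ ih₁ ih₂ =>
    obtain ⟨ψ₁, h₁⟩ := ih₁
    obtain ⟨ψ₂, h₂⟩ := ih₂
    exact ⟨ψ₁.imp ψ₂, fun E v xs => imp_congr (h₁ E v xs) (h₂ E v xs)⟩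
  | all φ ih =>
    obtain ⟨ψ, h⟩ := ih
    exact ⟨ψ.all, fun E v xs => forall_congr' fun a => h E v _⟩

theorem domSet_mem_eSet {n : ℕ} {A : Set U} {C E : Set (Fin (n + n) → U)}
    (h : E ∈ eSet L U A C) : domSet E ∈ eSet L U A (domSet C) := by
  intro φ
  obtain ⟨ψ, hψ⟩ := exists_boundedFormula_domSet A φ
  exact (hψ E default default).symm.trans ((h ψ).trans (hψ C default default))

/-- The set `D × ¬D`. -/
def prodCompl {U : Type u} {n : ℕ} (D : Set (Fin n → U)) : Set (Fin (n + n) → U) :=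
  {c | (fun i => c (Fin.castAdd n i)) ∈ D ∧ (fun i => c (Fin.natAdd n i)) ∉ D}

theorem append_mem_prodCompl {n : ℕ} {D : Set (Fin n → U)} {x y : Fin n → U} :
    Fin.append x y ∈ prodCompl D ↔ x ∈ D ∧ y ∉ D := by
  simp only [prodCompl, mem_setOf_eq, Fin.append_left, Fin.append_right]

theorem domSet_prodCompl {n : ℕ} {D : Set (Fin n → U)} {y : Fin n → U} (hy : y ∉ D) :
    domSet (prodCompl D) = D := by
  ext x
  simp only [domSet, append_mem_prodCompl, mem_setOf_eq]
  exact ⟨fun ⟨_, h, _⟩ => h, fun h => ⟨y, h, hy⟩⟩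

theorem exists_formula_prodCompl (L : FirstOrder.Language.{u, u}) {U : Type u} [L.Structure U]
    (n : ℕ) (A : Set U) :
    ∃ φ : ((expLang L n)[[↥A]]).Formula (Fin (n + n)), ∀ D : Set (Fin n → U),
      {c | FRealize U (addConsts U (expStr L U D) A) φ c} = prodCompl D := by
  refine ⟨((newRel L n A).formula fun i => Term.var (Fin.castAdd n i)) ⊓
    ((newRel L n A).formula fun i => Term.var (Fin.natAdd n i)).not, fun D => ?_⟩
  ext c
  let := addConsts U (expStr L U D) A
  refine Formula.realize_inf.trans (and_congr (fRealize_newRel A D _ _) ?_)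
  exact Formula.realize_not.trans (not_congr (fRealize_newRel A D _ _))

/-- Elements of `e(D × ¬D)` are of the form `D' × ¬D'`. -/
theorem not_mem_domSet_of_mem_eSet {n : ℕ} {A : Set U} {D : Set (Fin n → U)}
    {E : Set (Fin (n + n) → U)} (h : E ∈ eSet L U A (prodCompl D)) {x y : Fin n → U}
    (hxy : Fin.append x y ∈ E) : y ∉ domSet E := by
  let θ : ((expLang L (n + n))[[↥A]]).Formula (Empty ⊕ (Fin 3 × Fin n)) :=
    ((newRel L (n + n) A).formula fun i =>
      Term.var (Fin.append (fun i => Sum.inr (0, i)) (fun i => Sum.inr (1, i)) i)) ⊓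
    ((newRel L (n + n) A).formula fun i =>
      Term.var (Fin.append (fun i => Sum.inr (1, i)) (fun i => Sum.inr (2, i)) i))
  have hθ : ∀ E : Set (Fin (n + n) → U),
      SentRealize U (addConsts U (expStr L U E) A) (θ.iExs (Fin 3 × Fin n)) ↔
        ∃ x y z : Fin n → U, Fin.append x y ∈ E ∧ Fin.append y z ∈ E := by
    intro E
    let := addConsts U (expStr L U E) A
    have hrel : ∀ w : Fin 3 × Fin n → U, θ.Realize (Sum.elim default w) ↔
        Fin.append (fun i => w (0, i)) (fun i => w (1, i)) ∈ E ∧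
          Fin.append (fun i => w (1, i)) (fun i => w (2, i)) ∈ E := by
      intro w
      refine Formula.realize_inf.trans (and_congr ?_ ?_) <;>
      exact (fRealize_newRel A E _ _).trans (Iff.of_eq (congrArg (· ∈ E) 
        (comp_append (Sum.elim default w) _ _)))
    refine Formula.realize_iExs.trans ⟨?_, ?_⟩
    · rintro ⟨w, hw⟩
      exact ⟨_, _, _, (hrel w).1 hw⟩
    · rintro ⟨x, y, z, hw⟩
      exact ⟨fun p => ![x, y, z] p.1 p.2, (hrel _).2 hw⟩
  rintro ⟨z, hz⟩
  obtain ⟨x', y', z', h1, h2⟩ := (hθ _).1 ((h _).1 ((hθ E).2 ⟨x, y, z, hxy, hz⟩))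
  exact (append_mem_prodCompl.1 h1).2 (append_mem_prodCompl.1 h2).1

/-- `y` realizes over `P` the global coheir given by an ultrafilter on `M^n`. -/
def IsGeneric (L : FirstOrder.Language.{u, u}) {U : Type u} [L.Structure U] {n : ℕ} {M : Set U}
    (𝒰 : Ultrafilter (Fin n → M)) (P : Set U) (y : Fin n → U) : Prop :=
  ∀ φ : L.Formula (P ⊕ Fin n),
    (∀ᶠ x in (𝒰 : Filter (Fin n → M)), φ.Realize (Sum.elim (↑) fun i => (x i : U))) ↔
      φ.Realize (Sum.elim (↑) y)

section Generic

variable {n : ℕ} {M : Set U} {𝒰 : Ultrafilter (Fin n → M)}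

theorem IsGeneric.eventually_iff {P : Set U} {y : Fin n → U} (h : IsGeneric L 𝒰 P y)
    {ι : Type*} {w : ι → U} (hw : ∀ i, w i ∈ P) (φ : L.Formula (ι ⊕ Fin n)) :
    (∀ᶠ x in (𝒰 : Filter (Fin n → M)), φ.Realize (Sum.elim w fun i => (x i : U))) ↔
      φ.Realize (Sum.elim w y) := by
  have := h (φ.relabel (Sum.map (fun i => ⟨w i, hw i⟩) id))
  simp only [Formula.realize_relabel, Sum.elim_comp_map] at this
  exact this

theorem IsGeneric.mono {P Q : Set U} {y : Fin n → U} (h : IsGeneric L 𝒰 P y) (hQ : Q ⊆ P) :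
    IsGeneric L 𝒰 Q y :=
  fun φ => h.eventually_iff (fun i => hQ i.2) φ

theorem exists_isGeneric (hsat : IsSatStr U iS) (𝒰 : Ultrafilter (Fin n → M)) {P : Set U}
    (hP : #P < #U) : ∃ y, IsGeneric L 𝒰 P y := by
  obtain ⟨y, hy⟩ := hsat.exists_realize hP (↑) n {φ : L.Formula (P ⊕ Fin n) |
    ∀ᶠ x in (𝒰 : Filter (Fin n → M)), φ.Realize (Sum.elim (↑) fun i => (x i : U))} (by
      intro s hs
      have := (Filter.eventually_all_finset s).2 fun φ hφ => hs hφ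
      obtain ⟨x, hx⟩ := this.exists
      exact ⟨_, hx⟩)
  refine ⟨y, fun φ => ⟨fun h => hy φ h, fun h => ?_⟩⟩
  by_contra h'
  rw [← Ultrafilter.eventually_not] at h'
  exact Formula.realize_not.1 (hy φ.not (h'.mono fun x hx => Formula.realize_not.2 hx)) h

/-- Every type over a model extends to a coheir. -/
theorem exists_ultrafilter_isGeneric (M : L.ElementarySubstructure U) (a : Fin n → U) :
    ∃ 𝒰 : Ultrafilter (Fin n → ((M : L.Substructure U) : Set U)), ∀ y : Fin n → U,
      (∀ φ : L.Formula (((M : L.Substructure U) : Set U) ⊕ Fin n),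
        φ.Realize (Sum.elim (↑) y) ↔ φ.Realize (Sum.elim (↑) a)) →
      IsGeneric L 𝒰 ((M : L.Substructure U) : Set U) y := by
  classical
  let N : Set U := ((M : L.Substructure U) : Set U)
  let X : L.Formula (N ⊕ Fin n) → Set (Fin n → N) := fun φ =>
    {x | φ.Realize (Sum.elim (↑) fun i => (x i : U))}
  let T := {φ : L.Formula (N ⊕ Fin n) // φ.Realize (Sum.elim (↑) a)}
  have hne : ∀ φ : T, (X φ.1).Nonempty := by
    rintro ⟨φ, hφ⟩
    have h1 : (φ.iExs (Fin n)).Realize (M.subtype ∘ (id : M → M)) :=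
      Formula.realize_iExs.2 ⟨a, hφ⟩
    rw [M.subtype.map_formula, Formula.realize_iExs] at h1
    obtain ⟨x, hx⟩ := h1
    rw [← M.subtype.map_formula, Sum.comp_elim] at hx
    exact ⟨x, hx⟩
  have : Nonempty T := ⟨⟨⊤, BoundedFormula.realize_top.2 trivial⟩⟩
  have hbot : (⨅ φ : T, Filter.principal (X φ.1)).NeBot := by
    refine Filter.iInf_neBot_of_directed' ?_ fun φ => Filter.principal_neBot_iff.2 (hne φ)
    rintro ⟨φ, hφ⟩ ⟨ψ, hψ⟩
    refine ⟨⟨φ ⊓ ψ, Formula.realize_inf.2 ⟨hφ, hψ⟩⟩, ?_, ?_⟩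
    · exact Filter.principal_mono.2 fun x hx => (Formula.realize_inf.1 hx).1
    · exact Filter.principal_mono.2 fun x hx => (Formula.realize_inf.1 hx).2
  have hmem : ∀ φ : L.Formula (N ⊕ Fin n), φ.Realize (Sum.elim (↑) a) →
      ∀ᶠ x in (Ultrafilter.of (⨅ φ : T, Filter.principal (X φ.1)) : Filter (Fin n → N)),
        φ.Realize (Sum.elim (↑) fun i => (x i : U)) := fun φ hφ =>
    Ultrafilter.of_le _ (Filter.mem_iInf_of_mem (⟨φ, hφ⟩ : T) (Filter.mem_principal_self _))
  refine ⟨Ultrafilter.of (⨅ φ : T, Filter.principal (X φ.1)), fun y hy φ => ?_⟩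
  rw [hy]
  refine ⟨fun h => ?_, hmem φ⟩
  by_contra h'
  obtain ⟨x, hx, hx'⟩ := (h.and (hmem φ.not (Formula.realize_not.2 h'))).exists
  exact Formula.realize_not.1 hx' hx

/-- The coordinates of the tuples that precede the tuple with index `i`. -/
def coordsBelow {U : Type u} {n : ℕ} {I : Type*} [Preorder I] (s : I → Fin n → U) (i : I) :
    Set U :=
  {u | ∃ j < i, ∃ q, s j q = u}

/-- A Morley sequence over `M` of the global coheir given by an ultrafilter. -/
def IsMorleySeq (L : FirstOrder.Language.{u, u}) {U : Type u} [L.Structure U] {n : ℕ} {M : Set U}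
    (𝒰 : Ultrafilter (Fin n → M)) {I : Type*} [Preorder I] (s : I → Fin n → U) : Prop :=
  ∀ i, IsGeneric L 𝒰 (M ∪ coordsBelow s i) (s i)

theorem IsMorleySeq.comp {I J : Type*} [Preorder I] [Preorder J] {s : I → Fin n → U}
    (hs : IsMorleySeq L 𝒰 s) {j : J → I} (hj : StrictMono j) : IsMorleySeq L 𝒰 (s ∘ j) := by
  refine fun i => (hs (j i)).mono (union_subset_union_right _ ?_)
  rintro _ ⟨l, hl, q, rfl⟩
  exact ⟨j l, hj hl, q, rfl⟩

theorem isMorleySeq_pair {a c : Fin n → U} (ha : IsGeneric L 𝒰 M a)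
    (hc : IsGeneric L 𝒰 (M ∪ range a) c) : IsMorleySeq L 𝒰 ![a, c] := by
  intro i
  fin_cases i
  · refine ha.mono (union_subset subset_rfl ?_)
    rintro _ ⟨l, hl, -⟩
    exact absurd hl (Fin.not_lt_zero l)
  · refine hc.mono (union_subset_union_right _ ?_)
    rintro _ ⟨l, hl, q, rfl⟩
    obtain rfl : l = 0 := by
      simpa [Fin.lt_one_iff] using hl
    exact ⟨q, rfl⟩

theorem IsMorleySeq.realize_iff {m : ℕ} {t t' : Fin m → Fin n → U} (ht : IsMorleySeq L 𝒰 t)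
    (ht' : IsMorleySeq L 𝒰 t') (φ : L.Formula (M ⊕ (Fin m × Fin n))) :
    φ.Realize (Sum.elim (↑) fun p => t p.1 p.2) ↔
      φ.Realize (Sum.elim (↑) fun p => t' p.1 p.2) := by
  induction m with
  | zero =>
    rw [Subsingleton.elim (fun p : Fin 0 × Fin n => t p.1 p.2) fun p => t' p.1 p.2]
  | succ m ih =>
    let e : M ⊕ (Fin (m + 1) × Fin n) → (M ⊕ (Fin m × Fin n)) ⊕ Fin n :=
      Sum.elim (Sum.inl ∘ Sum.inl) fun p => Fin.lastCases
        (motive := fun _ => (M ⊕ (Fin m × Fin n)) ⊕ Fin n)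
        (Sum.inr p.2) (fun j => Sum.inl (Sum.inr (j, p.2))) p.1
    have key : ∀ t : Fin (m + 1) → Fin n → U, IsMorleySeq L 𝒰 t →
        (φ.Realize (Sum.elim (↑) fun p => t p.1 p.2) ↔
          ∀ᶠ x in (𝒰 : Filter (Fin n → M)), (φ.relabel e).Realize (Sum.elim
            (Sum.elim (↑) fun p : Fin m × Fin n => t p.1.castSucc p.2) fun i => (x i : U))) := by
      intro t ht
      rw [(ht (Fin.last m)).eventually_iff, Formula.realize_relabel]
      · refine Iff.of_eq (congrArg _ (funext fun i => ?_))
        rcases i with i | ⟨j, q⟩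
        · rfl
        · refine Fin.lastCases ?_ (fun j => ?_) j <;> simp [e]
      · rintro (i | ⟨j, q⟩)
        · exact Or.inl i.2
        · exact Or.inr ⟨j.castSucc, Fin.castSucc_lt_last j, q, rfl⟩
    rw [key t ht, key t' ht']
    refine Filter.eventually_congr (Filter.Eventually.of_forall fun x => ?_)
    have := ih (ht.comp Fin.strictMono_castSucc) (ht'.comp Fin.strictMono_castSucc)
      ((φ.relabel e).relabel (Sum.elim id fun i => Sum.inl (x i)))
    rw [Formula.realize_relabel (φ := φ.relabel e), Formula.realize_relabel (φ := φ.relabel e),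
      Sum.comp_elim, Sum.comp_elim] at this
    exact this

theorem IsMorleySeq.exists_autFix (hsat : IsSatStr U iS) (hreg : (#U).IsRegular) (hM : #M < #U)
    {m : ℕ} {t t' : Fin m → Fin n → U} (ht : IsMorleySeq L 𝒰 t) (ht' : IsMorleySeq L 𝒰 t') :
    ∃ g ∈ AutFix L U M, ∀ l, ⇑g ∘ t l = t' l := by
  obtain ⟨g, hg, hgt⟩ := hsat.exists_autFix hreg hM (ht.realize_iff ht')
  exact ⟨g, hg, fun l => funext fun q => congrFun hgt (l, q)⟩

theorem exists_isMorleySeq (hsat : IsSatStr U iS) (hinf : ℵ₀ ≤ #U) (hM : #M < #U)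
    (𝒰 : Ultrafilter (Fin n → M)) {I : Type u} [LinearOrder I] [WellFoundedLT I]
    (hI : ∀ i : I, #(Iio i) < #U) : ∃ s : I → Fin n → U, IsMorleySeq L 𝒰 s := by
  classical
  obtain ⟨y₀, -⟩ := exists_isGeneric (L := L) hsat 𝒰 hM
  let pick : Set U → Fin n → U := fun P => if h : ∃ y, IsGeneric L 𝒰 P y then h.choose else y₀
  let s : I → Fin n → U := WellFoundedLT.fix fun i s =>
    pick (M ∪ {u | ∃ (j : I) (hj : j < i), ∃ q, s j hj q = u})
  have hs : ∀ i, s i = pick (M ∪ {u | ∃ (j : I) (_ : j < i), ∃ q, s j q = u}) := fun i =>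
    WellFoundedLT.fix_eq _ i
  refine ⟨s, fun i => ?_⟩
  have hc : #↥(M ∪ coordsBelow s i) < #U := by
    refine (mk_union_le _ _).trans_lt (add_lt_of_lt hinf hM ?_)
    have hsub : coordsBelow s i ⊆ range fun p : Iio i × ULift.{u} (Fin n) => s p.1 p.2.down := by
      rintro _ ⟨j, hj, q, rfl⟩
      exact ⟨(⟨j, hj⟩, ⟨q⟩), rfl⟩
    refine (mk_le_mk_of_subset hsub).trans_lt (mk_range_le.trans_lt ?_)
    rw [mk_prod, lift_id, lift_id]
    exact mul_lt_of_lt hinf (hI i) ((lt_aleph0_of_finite _).trans_le hinf)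
  have hex : ∃ y, IsGeneric L 𝒰 (M ∪ coordsBelow s i) y := exists_isGeneric hsat 𝒰 hc
  have hsi : s i = hex.choose := by
    rw [hs i]
    simp only [exists_prop]
    exact dif_pos hex
  rw [hsi]
  exact hex.choose_spec

end Generic

/-- An indiscernible sequence of length `#U` whose consecutive terms, taken in one of the two
orders, are conjugate over `A` to an element of `D × ¬D`, contradicts pseudo-invariance. -/
theorem PseudoInv.not_conjugate {n : ℕ} {A : Set U} {D : Set (Fin n → U)}
    (hvc : FiniteVC (eSet L U (∅ : Set U) D)) (h : PseudoInv L U A (prodCompl D))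
    {I : Type u} [LinearOrder I] [SuccOrder I] [NoMaxOrder I] (hI : #I = #U)
    {s : I → Fin n → U}
    (hs : ∀ (m : ℕ) (j j' : Fin m → I), StrictMono j → StrictMono j' →
      ∃ g : U ≃[L] U, ∀ l, ⇑g ∘ s (j l) = s (j' l))
    {p q : I → I} (hpq : (p = id ∧ q = Order.succ) ∨ (p = Order.succ ∧ q = id))
    {a b : Fin n → U} (ha : a ∈ D) (hb : b ∉ D)
    (hab : ∀ i, ∃ g ∈ AutFix L U A, ⇑g ∘ a = s (p i) ∧ ⇑g ∘ b = s (q i)) : False := by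
  classical
  have hne : ∀ i, s i ≠ s (Order.succ i) := by
    intro i hi
    obtain ⟨g, -, h1, h2⟩ := hab i
    have hne : s (p i) ≠ s (q i) := by
      rw [← h1, ← h2]
      intro h3
      have := g.injective.comp_left h3
      exact hb (this ▸ ha)
    rcases hpq with ⟨rfl, rfl⟩ | ⟨rfl, rfl⟩
    · exact hne hi
    · exact hne hi.symm
  have hlt : ∀ i j, i < j → s i ≠ s j := by
    intro i j hij heq
    obtain ⟨g, hg⟩ := hs 2 ![i, j] ![i, Order.succ i] (by simpa [Fin.strictMono_iff_lt_succ])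
      (by simp [Fin.strictMono_iff_lt_succ])
    have h0 : ⇑g ∘ s i = s i := hg 0
    have h1 : ⇑g ∘ s j = s (Order.succ i) := hg 1
    rw [← heq, h0] at h1
    exact hne i h1
  have hinj : Function.Injective s := by
    intro i j heq
    by_contra hij
    rcases lt_or_gt_of_ne hij with h1 | h1
    · exact hlt i j h1 heq
    · exact hlt j i h1 heq.symm
  have hp : Function.Injective p := by
    rcases hpq with ⟨rfl, -⟩ | ⟨rfl, -⟩
    · exact Function.injective_id
    · exact Order.succ_injective
  let f : I → Fin (n + n) → U := fun i => Fin.append (s (p i)) (s (q i))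
  have hf : Function.Injective f := by
    refine fun i j hij => hp (hinj (funext fun l => ?_))
    have := congrFun hij (Fin.castAdd n l)
    simpa only [f, Fin.append_left] using this
  obtain ⟨N, hN⟩ := hvc
  obtain ⟨E, hE, hcard⟩ := h (Fin.append a b) (append_mem_prodCompl.2 ⟨ha, hb⟩) (range f)
    (by
      rintro _ ⟨i, rfl⟩
      obtain ⟨g, hg, h1, h2⟩ := hab i
      exact ⟨g, hg, by rw [comp_append, h1, h2]⟩)
    ((mk_range_eq f hf).trans hI) N
  have hJ : (N : Cardinal) ≤ #(f ⁻¹' E) := by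
    rw [inter_comm, ← image_preimage_eq_inter_range] at hcard
    exact hcard.trans mk_image_le
  obtain ⟨T, hTJ, hT⟩ : ∃ T : Finset I, ↑T ⊆ f ⁻¹' E ∧ T.card = N := by
    obtain ⟨T, hT⟩ := Cardinal.exists_finset_eq_card hJ
    exact ⟨T.map (Function.Embedding.subtype _), by simp, by simp [hT]⟩
  have hD' : domSet E ∈ eSet L U ∅ D := by
    have := domSet_mem_eSet hE
    rwa [domSet_prodCompl hb] at this
  have hpT : ∀ i ∈ T, s (p i) ∈ domSet E := fun i hi => ⟨_, hTJ hi⟩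
  have hqT : ∀ i ∈ T, s (q i) ∉ domSet E := fun i hi => not_mem_domSet_of_mem_eSet hE (hTJ hi)
  have hsucc : ∀ i ∈ T, ∀ j ∈ T, i < j → Order.succ i < j := by
    intro i hi j hj hij
    refine (Order.succ_le_of_lt hij).lt_of_ne ?_
    rintro rfl
    rcases hpq with ⟨rfl, rfl⟩ | ⟨rfl, rfl⟩
    · exact hqT i hi (hpT _ hj)
    · exact hqT _ hj (hpT i hi)
  have hbd : ∀ i, i ≤ p i ∧ p i ≤ Order.succ i ∧ i ≤ q i ∧ q i ≤ Order.succ i := by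
    rcases hpq with ⟨rfl, rfl⟩ | ⟨rfl, rfl⟩ <;> simp [Order.le_succ]
  let k := T.orderEmbOfFin hT
  have hkT : ∀ l, k l ∈ T := T.orderEmbOfFin_mem hT
  refine hN (T.image s) (by rw [Finset.card_image_of_injective _ hinj, hT]) fun H hH => ?_
  let j : Fin N → I := fun l => if s (k l) ∈ H then p (k l) else q (k l)
  have hj : ∀ l, k l ≤ j l ∧ j l ≤ Order.succ (k l) := fun l => by
    have := hbd (k l)
    simp only [j]
    split_ifs
    · exact ⟨this.1, this.2.1⟩
    · exact this.2.2
  obtain ⟨g, hg⟩ := hs N j k (fun l l' hl => ((hj l).2.trans_lt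
    (hsucc _ (hkT l) _ (hkT l') (k.strictMono hl))).trans_le (hj l').1) k.strictMono
  refine ⟨_, imgSet_mem_eSet (mem_autFix_empty g) hD', ?_⟩
  have hmem : ∀ l, s (k l) ∈ imgSet L U g (domSet E) ↔ s (k l) ∈ H := by
    intro l
    rw [← hg l, mem_imgSet_comp, hg l]
    by_cases hl : s (k l) ∈ H
    · simpa [j, hl] using hpT _ (hkT l)
    · simpa [j, hl] using hqT _ (hkT l)
  have hB : ∀ x ∈ (T.image s : Set (Fin n → U)), ∃ l, s (k l) = x := by
    intro x hx
    obtain ⟨i, hi, rfl⟩ := Finset.mem_image.1 hx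
    have : i ∈ range k := by
      rw [Finset.range_orderEmbOfFin]
      exact hi
    obtain ⟨l, rfl⟩ := this
    exact ⟨l, rfl⟩
  ext x
  constructor
  · rintro ⟨h1, h2⟩
    obtain ⟨l, rfl⟩ := hB x h2
    exact (hmem l).1 h1
  · intro hx
    obtain ⟨l, rfl⟩ := hB x (hH hx)
    exact ⟨(hmem l).2 hx, hH hx⟩

theorem PseudoInv.lascarInv (hsat : IsSatStr U iS) (hinacc : Cardinal.IsInaccessible #U)
    {n : ℕ} {A : Set U} {D : Set (Fin n → U)} (hvc : FiniteVC (eSet L U (∅ : Set U) D))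
    (h : PseudoInv L U A (prodCompl D)) : LascarInv L U A D := by
  intro M hAM hM f hf
  by_contra hne
  set N : Set U := ((M : L.Substructure U) : Set U) with hN
  have hinf : ℵ₀ ≤ #U := hinacc.aleph0_lt.le
  obtain ⟨a, g, hg, ha, hga⟩ : ∃ a, ∃ g ∈ AutFix L U N, a ∈ D ∧ ⇑g ∘ a ∉ D := by
    by_contra! hcon
    refine hne (Subset.antisymm ?_ fun a ha => ?_)
    · rintro _ ⟨a, ha, rfl⟩
      exact hcon a f hf ha
    · refine ⟨⇑f.symm ∘ a, hcon a f.symm (fun x hx => ?_) ha, ?_⟩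
      · exact (congrArg f.symm (hf x hx)).symm.trans (f.symm_apply_apply x)
      · funext i
        simp
  obtain ⟨𝒰, h𝒰⟩ := exists_ultrafilter_isGeneric M a
  have hgen : IsGeneric L 𝒰 N a := h𝒰 a fun φ => Iff.rfl
  have hgen' : IsGeneric L 𝒰 N (⇑g ∘ a) := h𝒰 _ fun φ => by
    rw [← StrongHomClass.realize_formula g φ (v := Sum.elim (↑) a), Sum.comp_elim]
    exact Iff.of_eq (congrArg (fun w => φ.Realize (Sum.elim w (⇑g ∘ a)))
      (funext fun x => (hg x x.2).symm))
  have hfin : ∀ x : Fin n → U, #(range x) < #U := fun x =>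
    (lt_aleph0_of_finite _).trans_le hinf
  obtain ⟨c, hc⟩ := exists_isGeneric (L := L) hsat 𝒰 (P := N ∪ (range a ∪ range (⇑g ∘ a)))
    ((mk_union_le _ _).trans_lt (add_lt_of_lt hinf hM
      ((mk_union_le _ _).trans_lt (add_lt_of_lt hinf (hfin _) (hfin _)))))
  let I := (#U).ord.ToType
  have hI : #I = #U := by simp [I]
  have : NoMaxOrder I := Cardinal.noMaxOrder hinf
  let : SuccOrder I := SuccOrder.ofLinearWellFoundedLT I
  obtain ⟨s, hs⟩ := exists_isMorleySeq (L := L) hsat hinf hM 𝒰 (I := I)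
    fun i => (mk_Iio_lt i (by simp [I])).trans_eq hI
  have hindisc : ∀ (m : ℕ) (j j' : Fin m → I), StrictMono j → StrictMono j' →
      ∃ g : U ≃[L] U, ∀ l, ⇑g ∘ s (j l) = s (j' l) := fun m j j' hj hj' => by
    obtain ⟨g, -, h⟩ := (hs.comp hj).exists_autFix hsat hinacc.isRegular hM (hs.comp hj')
    exact ⟨g, h⟩
  have hconj : ∀ x, IsMorleySeq L 𝒰 ![x, c] → ∀ i, ∃ g ∈ AutFix L U A,
      ⇑g ∘ x = s i ∧ ⇑g ∘ c = s (Order.succ i) := by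
    intro x hx i
    obtain ⟨g, hg, h⟩ := hx.exists_autFix hsat hinacc.isRegular hM
      (hs.comp (j := ![i, Order.succ i]) (by simp [Fin.strictMono_iff_lt_succ]))
    exact ⟨g, fun y hy => hg y (hAM hy), h 0, h 1⟩
  by_cases hcD : c ∈ D
  · have hx := isMorleySeq_pair hgen' (hc.mono (union_subset_union_right _ subset_union_right))
    exact h.not_conjugate hvc hI hindisc (Or.inr ⟨rfl, rfl⟩) hcD hga
      fun i => (hconj _ hx i).imp fun g hg => ⟨hg.1, hg.2.symm⟩
  · have hx := isMorleySeq_pair hgen (hc.mono (union_subset_union_right _ subset_union_left))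
    exact h.not_conjugate hvc hI hindisc (Or.inl ⟨rfl, rfl⟩) ha hcD (hconj _ hx)

end

/-- if `e(D)` has finite VC dimension, then: `D` Lascar invariant over `A`
iff every `L(A;D)`-definable set is pseudo-invariant over `A` iff `D × ¬D` is
pseudo-invariant over `A`. -/
theorem stmt19 (L : FirstOrder.Language.{u, u}) (U : Type u) [iS : L.Structure U]
    (hsat : IsSatStr U iS) (hinacc : Cardinal.IsInaccessible #U) (hcard : L.card < #U)
    (hram : IsRamseyCard (#U))
    (n : ℕ) (A : Set U) (hA : #A < #U)
    (D : Set (Fin n → U)) (hvc : FiniteVC (eSet L U (∅ : Set U) D)) :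
    (LascarInv L U A D ↔
      ∀ (k : ℕ) (φ : ((expLang L n)[[↥A]]).Formula (Fin k)),
        PseudoInv L U A
          {a : Fin k → U | FRealize U (addConsts U (expStr L U D) A) φ a}) ∧
    (LascarInv L U A D ↔
      PseudoInv L U A
        {c : Fin (n + n) → U |
          (fun i => c (Fin.castAdd n i)) ∈ D ∧ (fun i => c (Fin.natAdd n i)) ∉ D}) := by
  have h12 : LascarInv L U A D → ∀ (k : ℕ) (φ : ((expLang L n)[[↥A]]).Formula (Fin k)),
      PseudoInv L U A {a : Fin k → U | FRealize U (addConsts U (expStr L U D) A) φ a} :=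
    fun h _ φ => h.pseudoInv hsat hinacc hcard hA φ
  have h23 : (∀ (k : ℕ) (φ : ((expLang L n)[[↥A]]).Formula (Fin k)),
      PseudoInv L U A {a : Fin k → U | FRealize U (addConsts U (expStr L U D) A) φ a}) →
      PseudoInv L U A (prodCompl D) := fun h => by
    obtain ⟨φ, hφ⟩ := exists_formula_prodCompl L n A
    exact hφ D ▸ h _ φ
  have h31 : PseudoInv L U A (prodCompl D) → LascarInv L U A D :=
    fun h => h.lascarInv hsat hinacc hvc
  exact ⟨⟨h12, fun h => h31 (h23 h)⟩, ⟨fun h => h23 (h12 h), h31⟩⟩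

end Paper
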